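/- arXiv:math/0509576 — 2 statements merged into one kernel-verified Lean document; each statement's English description precedes it below -/
import Mathlib

section
/- Let Q be a Poisson random variable with mean μ > 0. Then P[Q ≤ √μ] ≤ exp( √μ + μ(e^{−1} − 1) ). Moreover, if μ ≥ 13, then P[Q ≤ √μ] ≤ 2^{−μ/2}. -/
open MeasureTheory ProbabilityTheory
open scoped ENNReal NNReal

lemma hasSum_exp_mul_poisson (m : ℝ≥0) (t : ℝ) :
    HasSum (fun n : ℕ ↦ Real.exp (-m) * m ^ n / n.factorial * Real.exp (t * n))
      (Real.exp (m * (Real.exp t - 1))) := by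
  convert! (NormedSpace.expSeries_div_hasSum_exp (m * Real.exp t : ℝ)).mul_left
    (Real.exp (-m)) using 1
  · ext n
    rw [mul_pow, ← Real.exp_nat_mul, mul_comm t]
    ring
  · rw [← Real.exp_eq_exp_ℝ, ← Real.exp_add]
    ring_nf

lemma integrable_exp_mul_poissonMeasure (m : ℝ≥0) (t : ℝ) :
    Integrable (fun n : ℕ ↦ Real.exp (t * n)) (poissonMeasure m) := by
  rw [integrable_poissonMeasure_iff]
  simpa only [Real.norm_eq_abs, Real.abs_exp] using (hasSum_exp_mul_poisson m t).summable

lemma mgf_poissonMeasure (m : ℝ≥0) (t : ℝ) :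
    mgf (fun n : ℕ ↦ (n : ℝ)) (poissonMeasure m) t = Real.exp (m * (Real.exp t - 1)) := by
  rw [mgf, integral_poissonMeasure]
  exact (hasSum_exp_mul_poisson m t).tsum_eq

/-- The Chernoff bound for the lower tail of a Poisson distribution. -/
lemma poissonMeasure_le_exp (m : ℝ≥0) (a : ℝ) {t : ℝ} (ht : t ≤ 0) :
    poissonMeasure m {n : ℕ | (n : ℝ) ≤ a} ≤
      ENNReal.ofReal (Real.exp (-t * a + m * (Real.exp t - 1))) := by
  have h := measure_le_le_exp_mul_mgf a ht (integrable_exp_mul_poissonMeasure m t)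
  rw [mgf_poissonMeasure, ← Real.exp_add] at h
  rw [← ofReal_measureReal]
  exact ENNReal.ofReal_le_ofReal h

lemma sqrt_add_mul_exp_neg_one_sub_one_le {x : ℝ} (hx : 13 ≤ x) :
    √x + x * (Real.exp (-1) - 1) ≤ Real.log 2 * (-x / 2) := by
  have hs : 3.6 ≤ √x := Real.le_sqrt_of_sq_le (by linarith)
  have hsq : √x * √x = x := Real.mul_self_sqrt (by linarith)
  have hle : 3.6 * √x ≤ x := by nlinarith
  have hcoef : 0.285 * x ≤ (1 - Real.exp (-1) - Real.log 2 / 2) * x := by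
    gcongr
    linarith [Real.exp_neg_one_lt_d9, Real.log_two_lt_d9]
  linarith

/-- If `Q` is Poisson with mean `μ > 0` then
`P[Q ≤ √μ] ≤ exp(√μ + μ(e^{−1} − 1))`; moreover if `μ ≥ 13` then
`P[Q ≤ √μ] ≤ 2^{−μ/2}`. -/
theorem poisson_lower_tail (m : ℝ≥0) (hm : 0 < m) :
    poissonMeasure m {n : ℕ | (n : ℝ) ≤ Real.sqrt m} ≤
        ENNReal.ofReal (Real.exp (Real.sqrt m + m * (Real.exp (-1) - 1))) ∧
      (13 ≤ (m : ℝ) →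
        poissonMeasure m {n : ℕ | (n : ℝ) ≤ Real.sqrt m} ≤
          ENNReal.ofReal ((2 : ℝ) ^ (-(m : ℝ) / 2))) := by
  have h : poissonMeasure m {n : ℕ | (n : ℝ) ≤ Real.sqrt m} ≤
      ENNReal.ofReal (Real.exp (Real.sqrt m + m * (Real.exp (-1) - 1))) := by
    simpa using poissonMeasure_le_exp m (Real.sqrt m) (t := -1) (by norm_num)
  refine ⟨h, fun h13 ↦ h.trans (ENNReal.ofReal_le_ofReal ?_)⟩
  rw [Real.rpow_def_of_pos two_pos]
  exact Real.exp_le_exp.2 (sqrt_add_mul_exp_neg_one_sub_one_le h13)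
end

section
/- Let d > 15 and let G' be the (3,d)-caterpillar: three stars S₁, S₂, S₃ each with d edges, whose roots form a path root₁–root₂–root₃ (the edges root₁–root₂ and root₂–root₃ being shared leaf-edges of adjacent stars). Let A be any IPD configuration on G' in which more than d/4 − 2 of the non-external leaves of star S₁ are in state D. Then there exists a sequence of at most six edges of G' such that applying the WSLS updates at these edges in order produces a configuration in which at least 3 of the non-external leaves of star S₃ are in state D. -/
/-- The Win-Stay Lose-Shift (WSLS) update at the edge `{u, v}`:
`true` encodes Cooperate (C) and `false` encodes Defect (D).
Rules: `(C,C) → (C,C)`, `(C,D) → (D,D)`, `(D,C) → (D,D)`, `(D,D) → (C,C)`;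
all other vertices are unchanged. -/
def wsls {V : Type*} [DecidableEq V] (A : V → Bool) (u v : V) : V → Bool :=
  fun w => if w = u ∨ w = v then (A u == A v) else A w

theorem wsls_right_of_ne {V : Type*} [DecidableEq V] {A : V → Bool} {u v : V}
    (hu : A u = false) (hv : A v = true) : wsls A u v v = false := by
  simp [wsls, hu, hv]

/-- Defection can be carried along a walk, using at most one update per step. -/
theorem SimpleGraph.Walk.exists_wsls_defect {V : Type*} [DecidableEq V] {G : SimpleGraph V}
    {u r : V} (p : G.Walk u r) (A : V → Bool) (hu : A u = false) :
    ∃ l : List (V × V), l.length ≤ p.length ∧ (∀ e ∈ l, G.Adj e.1 e.2) ∧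
      (l.foldl (fun B e => wsls B e.1 e.2) A) r = false := by
  induction p generalizing A with
  | nil => exact ⟨[], by simp, by simp, hu⟩
  | @cons u v r h p ih =>
    by_cases hv : A v = false
    · obtain ⟨l, hl, hadj, hr⟩ := ih A hv
      exact ⟨l, hl.trans (by simp), hadj, hr⟩
    · obtain ⟨l, hl, hadj, hr⟩ := ih _ (wsls_right_of_ne hu (by simpa using hv))
      refine ⟨(u, v) :: l, by simpa using hl, ?_, hr⟩
      simpa using ⟨h, fun a b hab => hadj (a, b) hab⟩

/-- A defecting vertex can make `n` of its neighbors in `S` defect with at most `n` updates. -/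
theorem exists_wsls_defect_neighbors {V : Type*} [DecidableEq V] {G : SimpleGraph V}
    {r : V} {S : Finset V} (hS : ∀ v ∈ S, G.Adj r v) (A : V → Bool) (hr : A r = false)
    (n : ℕ) (hn : n ≤ S.card) :
    ∃ l : List (V × V), l.length ≤ n ∧ (∀ e ∈ l, G.Adj e.1 e.2) ∧
      (l.foldl (fun B e => wsls B e.1 e.2) A) r = false ∧
      n ≤ (S.filter fun v => (l.foldl (fun B e => wsls B e.1 e.2) A) v = false).card := by
  induction n with
  | zero => exact ⟨[], by simp, by simp, hr, by simp⟩
  | succ n ih =>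
    obtain ⟨l, hl, hadj, hlr, hcard⟩ := ih (by omega)
    set B := l.foldl (fun B e => wsls B e.1 e.2) A with hB
    by_cases hall : ∀ v ∈ S, B v = false
    · refine ⟨l, by omega, hadj, hlr, ?_⟩
      rwa [← hB, Finset.filter_true_of_mem hall]
    · push Not at hall
      obtain ⟨w, hwS, hw⟩ := hall
      have hwt : B w = true := by simpa using hw
      refine ⟨l ++ [(r, w)], by simpa using hl, ?_, ?_, ?_⟩
      · intro e he
        rcases List.mem_append.1 he with he | he
        · exact hadj e he
        · rw [List.mem_singleton.1 he]
          exact hS w hwS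
      · simp [← hB, wsls, hlr, hwt]
      · refine Nat.succ_le_of_lt (hcard.trans_lt (Finset.card_lt_card ?_))
        refine Finset.ssubset_iff_of_subset ?_ |>.2 ⟨w, ?_, ?_⟩
        · intro v hv
          simp only [Finset.mem_filter] at hv ⊢
          refine ⟨hv.1, ?_⟩
          simp [← hB, wsls, hlr, hwt, hv.2]
        · simp [← hB, wsls, hlr, hwt, hwS]
        · simp [hw]


/-- Let `d > 15` and let `G` be the `(3,d)`-caterpillar: three
stars of degree `d` whose roots `f 0 – f 1 – f 2` form a path, all non-root
vertices being leaves.  If `A` is a configuration in which more than `d/4 − 2` of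
the non-external leaves of star `S₁` (the neighbors of `f 0` other than `f 1`)
defect, then there is a sequence of at most six edges of `G` such that applying
the WSLS updates at these edges in order yields a configuration in which at least
`3` of the non-external leaves of star `S₃` (the neighbors of `f 2` other than
`f 1`) defect. -/
theorem caterpillar_defection_spreads (d : ℕ) (hd : 15 < d)
    (V : Type*) [Fintype V] [DecidableEq V] (G : SimpleGraph V)
    [DecidableRel G.Adj]
    (f : Fin 3 → V) (hinj : Function.Injective f)
    (hcard : Fintype.card V = 3 * (d - 1) + 2)
    (hconn : G.Connected)
    (hdeg : ∀ j, G.degree (f j) = d)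
    (hpath : ∀ i j : Fin 3, G.Adj (f i) (f j) ↔ (i.1 + 1 = j.1 ∨ j.1 + 1 = i.1))
    (hleaf : ∀ v, v ∉ Set.range f → G.degree v = 1)
    (A : V → Bool)
    (hA : (d : ℝ) / 4 - 2 <
      (((G.neighborFinset (f 0) \ {f 1}).filter fun v => A v = false).card : ℝ)) :
    ∃ l : List (V × V), l.length ≤ 6 ∧ (∀ p ∈ l, G.Adj p.1 p.2) ∧
      3 ≤ ((G.neighborFinset (f 2) \ {f 1}).filter fun v =>
        (l.foldl (fun B p => wsls B p.1 p.2) A) v = false).card := by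
  have hd' : (16 : ℝ) ≤ d := by exact_mod_cast hd
  have hpos : 0 < ((G.neighborFinset (f 0) \ {f 1}).filter fun v => A v = false).card := by
    rw [← Nat.cast_pos (α := ℝ)]
    linarith
  obtain ⟨x, hx⟩ := Finset.card_pos.1 hpos
  simp only [Finset.mem_filter, Finset.mem_sdiff, SimpleGraph.mem_neighborFinset] at hx
  have h01 : G.Adj (f 0) (f 1) := (hpath 0 1).2 (by simp)
  have h12 : G.Adj (f 1) (f 2) := (hpath 1 2).2 (by simp)
  obtain ⟨l₁, hl₁, hadj₁, hr⟩ :=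
    (SimpleGraph.Walk.cons hx.1.1.symm (.cons h01 (.cons h12 .nil))).exists_wsls_defect A hx.2
  have hS : 3 ≤ (G.neighborFinset (f 2) \ {f 1}).card := by
    have h := Finset.le_card_sdiff {f 1} (G.neighborFinset (f 2))
    rw [G.card_neighborFinset_eq_degree, hdeg, Finset.card_singleton] at h
    omega
  obtain ⟨l₂, hl₂, hadj₂, -, hcard₂⟩ :=
    exists_wsls_defect_neighbors (G := G) (r := f 2)
      (fun v hv => by simp_all) _ hr 3 hS
  refine ⟨l₁ ++ l₂, ?_, ?_, ?_⟩
  · simp only [SimpleGraph.Walk.length_cons, SimpleGraph.Walk.length_nil] at hl₁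
    rw [List.length_append]
    omega
  · intro e he
    exact (List.mem_append.1 he).elim (hadj₁ e) (hadj₂ e)
  · rwa [List.foldl_append]
end
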